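/- Let 1 < q ≤ p < ∞ and suppose there is a constant M such that ‖[b,T]f‖_{WM^p_q} ≤ M ‖f‖_{M^p_q} for every bounded measurable complex-valued function f supported in a cube. Then b ∈ BMO and ‖b‖_* ≤ C M, where C depends only on n, p, q and Ω. -/

import Mathlib

open MeasureTheory ENNReal

noncomputable section

/-- `ℝⁿ` with the Euclidean norm. -/
abbrev En (n : ℕ) := EuclideanSpace ℝ (Fin n)

/-- The open cube in `ℝⁿ` centered at `c` with half side length `r`. -/
def cube {n : ℕ} (c : En n) (r : ℝ) : Set (En n) := {y | ∀ i, |y i - c i| < r}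

/-- Morrey norm `‖f‖_{M^p_q}`. -/
def morreyNorm {n : ℕ} (p q : ℝ) (f : En n → ℂ) : ℝ≥0∞ :=
  ⨆ (c : En n) (r : ℝ) (_ : 0 < r),
    volume (cube c r) ^ (1 / p - 1 / q) *
      (∫⁻ y in cube c r, (‖f y‖₊ : ℝ≥0∞) ^ q) ^ (1 / q)

/-- Weak Morrey norm `‖f‖_{WM^p_q}`. -/
def weakMorreyNorm {n : ℕ} (p q : ℝ) (f : En n → ℂ) : ℝ≥0∞ :=
  ⨆ (c : En n) (r : ℝ) (_ : 0 < r),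
    volume (cube c r) ^ (1 / p - 1 / q) *
      ⨆ (t : ℝ) (_ : 0 < t),
        (ENNReal.ofReal t ^ q * volume {y ∈ cube c r | t < ‖f y‖}) ^ (1 / q)

/-- Weak Lebesgue quasinorm `‖f‖_{L^{p,∞}}`. -/
def weakLpNorm {n : ℕ} (p : ℝ) (f : En n → ℂ) : ℝ≥0∞ :=
  ⨆ (t : ℝ) (_ : 0 < t),
    ENNReal.ofReal t * volume {x : En n | t < ‖f x‖} ^ (1 / p)

/-- The average `b_Q` of `b` over the cube `Q = cube c r`. -/
def cubeAvg {n : ℕ} (b : En n → ℝ) (c : En n) (r : ℝ) : ℝ :=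
  (∫ x in cube c r, b x) / (volume (cube c r)).toReal

/-- The BMO seminorm `‖b‖_*`. -/
def bmoSeminorm {n : ℕ} (b : En n → ℝ) : ℝ≥0∞ :=
  ⨆ (c : En n) (r : ℝ) (_ : 0 < r),
    (volume (cube c r))⁻¹ *
      ∫⁻ x in cube c r, (‖b x - cubeAvg b c r‖₊ : ℝ≥0∞)

/-- The Lipschitz (Hölder) seminorm `‖b‖_{Lip_α}`. -/
def lipSeminorm {n : ℕ} (α : ℝ) (b : En n → ℝ) : ℝ≥0∞ :=
  ⨆ (x : En n) (y : En n) (_ : x ≠ y),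
    (‖b x - b y‖₊ : ℝ≥0∞) / edist x y ^ α

/-- `sup_Q |Q|^{-(1+α/n)} ∫_Q |b - b_Q|`. -/
def lipAvgNorm {n : ℕ} (α : ℝ) (b : En n → ℝ) : ℝ≥0∞ :=
  ⨆ (c : En n) (r : ℝ) (_ : 0 < r),
    volume (cube c r) ^ (-(1 + α / (n : ℝ))) *
      ∫⁻ x in cube c r, (‖b x - cubeAvg b c r‖₊ : ℝ≥0∞)

lemma cube_eq_preimage {n : ℕ} (c : En n) (r : ℝ) :
    cube c r = (fun y : En n => (WithLp.ofLp y)) ⁻¹'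
      (Set.univ.pi fun i => Set.Ioo (c i - r) (c i + r)) := by
  ext y
  simp only [cube, Set.mem_ofPred_eq, Set.mem_preimage, Set.mem_univ_pi, Set.mem_Ioo, abs_lt]
  refine forall_congr' fun i => ?_
  constructor <;> rintro ⟨h1, h2⟩ <;> constructor <;> linarith

lemma volume_cube {n : ℕ} (c : En n) {r : ℝ} (hr : 0 < r) :
    volume (cube c r) = ENNReal.ofReal ((2 * r) ^ n) := by
  rw [cube_eq_preimage]
  have := (EuclideanSpace.volume_preserving_symm_measurableEquiv_toLp (Fin n)).measure_preimage
    (s := Set.univ.pi fun i => Set.Ioo (c i - r) (c i + r))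
    (MeasurableSet.univ_pi fun i => measurableSet_Ioo).nullMeasurableSet
  refine this.trans ?_
  rw [volume_pi_pi]
  simp only [Real.volume_Ioo]
  have : ∀ i : Fin n, c i + r - (c i - r) = 2 * r := fun i => by ring
  simp only [this, Finset.prod_const, Finset.card_univ, Fintype.card_fin]
  rw [ENNReal.ofReal_pow (by positivity)]

lemma isOpen_cube {n : ℕ} (c : En n) (r : ℝ) : IsOpen (cube c r) := by
  rw [cube_eq_preimage]
  exact (isOpen_set_pi Set.finite_univ fun i _ => isOpen_Ioo).preimage
    (PiLp.continuous_ofLp 2 _)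

/-- closed cube -/
def ccube {n : ℕ} (c : En n) (r : ℝ) : Set (En n) := {y | ∀ i, |y i - c i| ≤ r}

lemma cube_subset_ccube {n : ℕ} (c : En n) (r : ℝ) : cube c r ⊆ ccube c r :=
  fun _ hy i => (hy i).le

lemma isClosed_ccube {n : ℕ} (c : En n) (r : ℝ) : IsClosed (ccube c r) := by
  have : ccube c r = ⋂ i, {y : En n | |y i - c i| ≤ r} := by
    ext y; simp [ccube]
  rw [this]
  refine isClosed_iInter fun i => isClosed_le ?_ continuous_const
  fun_prop

lemma norm_le_of_coord {n : ℕ} (w : En n) {a : ℝ} (h : ∀ i, |w i| ≤ a) :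
    ‖w‖ ≤ n * a := by
  rcases Nat.eq_zero_or_pos n with rfl | hn
  · have : w = 0 := Subsingleton.elim _ _
    simp [this]
  have ha : 0 ≤ a := (abs_nonneg _).trans (h ⟨0, hn⟩)
  have hn1 : (1 : ℝ) ≤ n := by exact_mod_cast hn
  rw [EuclideanSpace.norm_eq]
  apply Real.sqrt_le_iff.2
  refine ⟨by positivity, ?_⟩
  calc ∑ i, ‖w i‖ ^ 2 ≤ ∑ i : Fin n, a ^ 2 := by
        apply Finset.sum_le_sum
        intro i _
        exact pow_le_pow_left₀ (norm_nonneg _) (h i) 2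
    _ = n * a ^ 2 := by simp
    _ ≤ (n * a) ^ 2 := by
        nlinarith [mul_le_mul_of_nonneg_right hn1 (by positivity : 0 ≤ n * a ^ 2)]

lemma isCompact_ccube {n : ℕ} (c : En n) (r : ℝ) : IsCompact (ccube c r) := by
  refine Metric.isCompact_of_isClosed_isBounded (isClosed_ccube c r) ?_
  refine (Metric.isBounded_closedBall (x := c) (r := n * r)).subset ?_
  intro y hy
  rw [Metric.mem_closedBall, dist_eq_norm]
  exact norm_le_of_coord _ fun i => by simpa using hy i

lemma median_exists {X : Type*} [MeasurableSpace X] (μ : Measure X) [IsFiniteMeasure μ]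
    (hμ : μ Set.univ ≠ 0) (g : X → ℝ) (hg : Measurable g) :
    ∃ a : ℝ, μ Set.univ / 2 ≤ μ {x | g x ≤ a} ∧ μ Set.univ / 2 ≤ μ {x | a ≤ g x} := by
  have hm : ∀ t, MeasurableSet {x | g x ≤ t} := fun t => hg measurableSet_Iic
  have hm' : ∀ t, MeasurableSet {x | t ≤ g x} := fun t => hg measurableSet_Ici
  have hfin : μ Set.univ ≠ ⊤ := measure_ne_top _ _
  have hhalf : μ Set.univ / 2 < μ Set.univ := ENNReal.half_lt_self hμ hfin
  set S : Set ℝ := {t | μ Set.univ / 2 ≤ μ {x | g x ≤ t}} with hS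
  have hmono : Monotone fun t : ℝ => {x | g x ≤ t} := fun s t hst x hx => le_trans hx hst
  have hSne : S.Nonempty := by
    have h1 := tendsto_measure_iUnion_atTop (μ := μ) hmono
    have h2 : (⋃ t : ℝ, {x | g x ≤ t}) = Set.univ :=
      Set.eq_univ_of_forall fun x => Set.mem_iUnion.2 ⟨g x, le_refl (g x)⟩
    rw [h2] at h1
    obtain ⟨t, ht⟩ := (h1.eventually_const_lt hhalf).exists
    exact ⟨t, ht.le⟩
  have hSbd : BddBelow S := by
    have h1 := tendsto_measure_iInter_atBot (μ := μ) (fun t => (hm t).nullMeasurableSet) hmono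
      ⟨0, measure_ne_top _ _⟩
    have h2 : (⋂ t : ℝ, {x | g x ≤ t}) = ∅ := by
      refine Set.eq_empty_of_forall_notMem fun x hx => ?_
      have := Set.mem_iInter.1 hx (g x - 1)
      simp only [Set.mem_ofPred_eq] at this
      linarith
    rw [h2, measure_empty] at h1
    have h3 : 0 < μ Set.univ / 2 := ENNReal.half_pos hμ
    obtain ⟨t, ht⟩ := (h1.eventually_lt_const h3).exists
    refine ⟨t, fun s hs => ?_⟩
    by_contra hlt
    push Not at hlt
    have : μ {x | g x ≤ s} ≤ μ {x | g x ≤ t} := measure_mono (hmono hlt.le)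
    exact absurd (hs.trans this) (not_le.2 ht)
  refine ⟨sInf S, ?_, ?_⟩
  · obtain ⟨u, hu1, hu2, hu3⟩ := exists_seq_strictAnti_tendsto (sInf S)
    have h1 := tendsto_measure_iInter_atTop (μ := μ) (s := fun k => {x | g x ≤ u k})
      (fun t => (hm _).nullMeasurableSet)
      (fun i j hij => hmono (hu1.antitone hij)) ⟨0, measure_ne_top _ _⟩
    have h2 : (⋂ k, {x | g x ≤ u k}) = {x | g x ≤ sInf S} := by
      ext x
      simp only [Set.mem_iInter, Set.mem_ofPred_eq]
      exact ⟨fun h => ge_of_tendsto' hu3 h, fun h k => h.trans (hu2 k).le⟩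
    rw [h2] at h1
    refine ge_of_tendsto' h1 fun k => ?_
    obtain ⟨t, ht, htk⟩ := exists_lt_of_csInf_lt hSne (hu2 k)
    exact le_trans ht (measure_mono (hmono htk.le))
  · obtain ⟨u, hu1, hu2, hu3⟩ := exists_seq_strictMono_tendsto (sInf S)
    have h1 := tendsto_measure_iInter_atTop (μ := μ) (s := fun k => {x | u k ≤ g x})
      (fun t => (hm' _).nullMeasurableSet)
      (fun i j hij x hx => le_trans (hu1.monotone hij) hx) ⟨0, measure_ne_top _ _⟩
    have h2 : (⋂ k, {x | u k ≤ g x}) = {x | sInf S ≤ g x} := by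
      ext x
      simp only [Set.mem_iInter, Set.mem_ofPred_eq]
      exact ⟨fun h => le_of_tendsto' hu3 h, fun h k => (hu2 k).le.trans h⟩
    rw [h2] at h1
    refine ge_of_tendsto' h1 fun k => ?_
    have h4 : u k ∉ S := fun h => absurd (csInf_le hSbd h) (not_le.2 (hu2 k))
    have h5 : μ {x | g x ≤ u k} < μ Set.univ / 2 := not_le.1 h4
    by_contra h6
    push Not at h6
    have h7 : μ Set.univ ≤ μ {x | g x ≤ u k} + μ {x | u k ≤ g x} := by
      refine le_trans (measure_mono ?_) (measure_union_le _ _)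
      intro x _
      exact le_total (g x) (u k)
    have h8 := ENNReal.add_lt_add h5 h6
    rw [ENNReal.add_halves] at h8
    exact absurd h7 (not_le.2 h8)

lemma kernel_lower {n : ℕ} (Ω : En n → ℝ)
    (hΩhom : ∀ l : ℝ, 0 < l → ∀ x : En n, x ≠ 0 → Ω (l • x) = Ω x)
    (hΩcont : ContinuousOn Ω {(0 : En n)}ᶜ)
    (hΩne : ∃ x : En n, x ≠ 0 ∧ Ω x ≠ 0) :
    ∃ (u : En n) (κ : ℝ) (e : ℝ), 0 < κ ∧ (e = 1 ∨ e = -1) ∧ ∀ (c : En n) (r : ℝ), 0 < r →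
      ∀ x ∈ cube c r, ∀ y ∈ ccube (c - r • u) r, x ≠ y ∧
        κ / (2 * r) ^ n ≤ e * (Ω (x - y) / ‖x - y‖ ^ n) := by
  obtain ⟨z, hz, hΩz⟩ := hΩne
  have hcz : ContinuousAt Ω z := hΩcont.continuousAt (isOpen_compl_singleton.mem_nhds hz)
  have hpos : 0 < |Ω z| / 2 := by positivity
  obtain ⟨d0, hd0, hball⟩ := Metric.continuousAt_iff.1 hcz _ hpos
  set d := min d0 ‖z‖ with hd
  have hzn : 0 < ‖z‖ := norm_pos_iff.2 hz
  have hdpos : 0 < d := lt_min hd0 hzn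
  set L : ℝ := (2 * n + 1) / d with hL
  have hLpos : 0 < L := by positivity
  obtain ⟨e, he, hez⟩ : ∃ e : ℝ, (e = 1 ∨ e = -1) ∧ e * Ω z = |Ω z| := by
    rcases le_total 0 (Ω z) with h | h
    · exact ⟨1, Or.inl rfl, by rw [abs_of_nonneg h, one_mul]⟩
    · exact ⟨-1, Or.inr rfl, by rw [abs_of_nonpos h]; ring⟩
  have heabs : |e| = 1 := by rcases he with rfl | rfl <;> simp
  refine ⟨L • z, |Ω z| / 2 * (2 / (L * (‖z‖ + d))) ^ n, e, by positivity, he, ?_⟩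
  intro c r hr x hx y hy
  set w : En n := x - y - (L * r) • z with hw
  have hwi : ∀ i, |w i| ≤ 2 * r := by
    intro i
    have h1 := hx i
    have h2 := hy i
    have : w i = (x i - c i) - (y i - (c - r • (L • z)) i) := by
      simp [hw]; ring
    rw [this]
    refine (abs_sub _ _).trans ?_
    linarith
  have hwn : ‖w‖ ≤ n * (2 * r) := norm_le_of_coord w hwi
  set m : En n := (L * r)⁻¹ • (x - y) with hm
  have hLr : 0 < L * r := by positivity
  have hmz : m - z = (L * r)⁻¹ • w := by
    rw [hm, hw, smul_sub _ (x - y), smul_smul, inv_mul_cancel₀ hLr.ne', one_smul]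
  have hmd : ‖m - z‖ < d := by
    rw [hmz, norm_smul, Real.norm_of_nonneg (by positivity), inv_mul_lt_iff₀ hLr]
    have : L * r * d = (2 * n + 1) * r := by rw [hL]; field_simp
    rw [this]
    nlinarith
  have hm0 : m ≠ 0 := by
    intro h0
    rw [h0, zero_sub, norm_neg] at hmd
    exact absurd hmd (not_lt.2 (min_le_right _ _))
  have hxy : x - y = (L * r) • m := by
    rw [hm, smul_smul, mul_inv_cancel₀ hLr.ne', one_smul]
  have hxy0 : x - y ≠ 0 := by
    rw [hxy]; exact smul_ne_zero hLr.ne' hm0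
  refine ⟨fun h => hxy0 (sub_eq_zero.2 h), ?_⟩
  have hΩm : |Ω m - Ω z| < |Ω z| / 2 := by
    have := hball (x := m) (by rw [dist_eq_norm]; exact hmd.trans_le (min_le_left _ _))
    rwa [Real.dist_eq] at this
  have hΩxy : Ω (x - y) = Ω m := by rw [hxy]; exact hΩhom _ hLr _ hm0
  have hlow : |Ω z| / 2 ≤ e * Ω (x - y) := by
    rw [hΩxy]
    have h1 : |e * (Ω m - Ω z)| < |Ω z| / 2 := by rw [abs_mul, heabs, one_mul]; exact hΩm
    have h2 := (abs_lt.1 h1).1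
    have : e * Ω m = e * Ω z + e * (Ω m - Ω z) := by ring
    rw [this, hez]; linarith
  have hnorm : ‖x - y‖ ≤ L * r * (‖z‖ + d) := by
    rw [hxy, norm_smul, Real.norm_of_nonneg hLr.le]
    refine mul_le_mul_of_nonneg_left ?_ hLr.le
    have : m = z + (m - z) := by abel
    rw [this]
    exact (norm_add_le _ _).trans (by linarith)
  have hxyn : 0 < ‖x - y‖ := norm_pos_iff.2 hxy0
  calc |Ω z| / 2 * (2 / (L * (‖z‖ + d))) ^ n / (2 * r) ^ n
      = |Ω z| / 2 / (L * r * (‖z‖ + d)) ^ n := by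
        rw [mul_div_assoc, ← div_pow, div_eq_mul_inv (|Ω z| / 2) ((L * r * (‖z‖ + d)) ^ n),
          ← inv_pow]
        congr 2
        field_simp
    _ ≤ |Ω z| / 2 / ‖x - y‖ ^ n := by gcongr
    _ ≤ e * Ω (x - y) / ‖x - y‖ ^ n := by gcongr
    _ = _ := by ring

lemma layer {X : Type*} [MeasurableSpace X] (μ : Measure X) (g : X → ℝ) (hg : AEMeasurable g μ)
    {A v q : ℝ} (hA : 0 < A) (hv : 0 < v) (hq : 1 < q) (hμ : μ Set.univ ≤ ENNReal.ofReal v)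
    (h : ∀ s : ℝ, 0 < s → μ {x | s < g x} ≤ ENNReal.ofReal ((A / s) ^ q * v)) :
    ∫⁻ x, ENNReal.ofReal (g x) ∂μ ≤ ENNReal.ofReal (q / (q - 1) * A * v) := by
  have hq1 : 0 < q - 1 := by linarith
  have h0 : ∀ x, ENNReal.ofReal (g x) = ENNReal.ofReal (max (g x) 0) := by
    intro x; rw [ENNReal.ofReal_max]; simp
  simp_rw [h0]
  rw [lintegral_eq_lintegral_meas_lt μ (f := fun x => max (g x) 0) (Filter.Eventually.of_forall fun x => le_max_right _ _)
    (hg.max aemeasurable_const)]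
  have hset : ∀ t ∈ Set.Ioi (0 : ℝ), μ {a | t < max (g a) 0} = μ {a | t < g a} := by
    intro t ht
    congr 1
    ext a
    simp only [Set.mem_ofPred_eq, lt_max_iff]
    exact or_iff_left (not_lt.2 (le_of_lt ht))
  rw [setLIntegral_congr_fun measurableSet_Ioi hset]
  rw [← Set.Ioc_union_Ioi_eq_Ioi hA.le, lintegral_union measurableSet_Ioi
    (Set.Ioc_disjoint_Ioi le_rfl)]
  have h1 : ∫⁻ t in Set.Ioc 0 A, μ {a | t < g a} ≤ ENNReal.ofReal (A * v) := by
    calc ∫⁻ t in Set.Ioc 0 A, μ {a | t < g a} ≤ ∫⁻ t in Set.Ioc 0 A, ENNReal.ofReal v :=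
          lintegral_mono fun t => (measure_mono (Set.subset_univ _)).trans hμ
      _ = ENNReal.ofReal (A * v) := by
          rw [setLIntegral_const, Real.volume_Ioc, sub_zero, ← ENNReal.ofReal_mul hv.le, mul_comm]
  have h2 : ∫⁻ t in Set.Ioi A, μ {a | t < g a} ≤ ENNReal.ofReal (1 / (q - 1) * A * v) := by
    have hintg : IntegrableOn (fun t : ℝ => A ^ q * v * t ^ (-q)) (Set.Ioi A) :=
      (integrableOn_Ioi_rpow_of_lt (by linarith) hA).const_mul _
    calc ∫⁻ t in Set.Ioi A, μ {a | t < g a}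
        ≤ ∫⁻ t in Set.Ioi A, ENNReal.ofReal (A ^ q * v * t ^ (-q)) := by
          refine setLIntegral_mono' measurableSet_Ioi fun t ht => ?_
          have ht0 : 0 < t := hA.trans ht
          refine (h t ht0).trans (le_of_eq ?_)
          congr 1
          rw [Real.div_rpow hA.le ht0.le, Real.rpow_neg ht0.le]
          field_simp
      _ = ENNReal.ofReal (∫ t in Set.Ioi A, A ^ q * v * t ^ (-q)) := by
          rw [ofReal_integral_eq_lintegral_ofReal hintg]
          filter_upwards [ae_restrict_mem measurableSet_Ioi] with t ht
          have ht0 : 0 < t := hA.trans ht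
          simp only [Pi.zero_apply]
          positivity
      _ = ENNReal.ofReal (1 / (q - 1) * A * v) := by
          congr 1
          rw [integral_const_mul, integral_Ioi_rpow_of_lt (by linarith) hA,
            Real.rpow_add hA, Real.rpow_neg hA.le, Real.rpow_one]
          have : -q + 1 ≠ 0 := by linarith
          have hAq : 0 < A ^ q := by positivity
          field_simp
          ring
  refine (add_le_add h1 h2).trans ?_
  rw [← ENNReal.ofReal_add (by positivity) (by positivity)]
  apply ENNReal.ofReal_le_ofReal
  apply le_of_eq
  field_simp
  ring

lemma morrey_indicator {n : ℕ} {p q : ℝ} (hq : 1 < q) (hqp : q ≤ p) (F : Set (En n))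
    (hF : MeasurableSet F) :
    morreyNorm p q (F.indicator fun _ => (1 : ℂ)) ≤ volume F ^ (1 / p) := by
  unfold morreyNorm
  refine iSup_le fun c => iSup_le fun r => iSup_le fun hr => ?_
  have hq0 : 0 < q := by linarith
  have hp0 : 0 < p := by linarith
  have h1 : ∫⁻ y in cube c r, (‖F.indicator (fun _ => (1 : ℂ)) y‖₊ : ℝ≥0∞) ^ q
      = volume (F ∩ cube c r) := by
    have : ∀ y, (‖F.indicator (fun _ => (1 : ℂ)) y‖₊ : ℝ≥0∞) ^ q
        = F.indicator (fun _ => (1 : ℝ≥0∞)) y := by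
      intro y
      by_cases hy : y ∈ F <;> simp [hy, hq0]
    simp_rw [this]
    rw [lintegral_indicator hF]
    simp [Measure.restrict_apply, hF]
  rw [h1]
  have hV0 : volume (cube c r) ≠ 0 := by
    rw [volume_cube c hr]; simp; positivity
  have hVt : volume (cube c r) ≠ ⊤ := by
    rw [volume_cube c hr]; exact ENNReal.ofReal_ne_top
  have hexp : 0 ≤ 1 / q - 1 / p := by
    rw [sub_nonneg]; exact one_div_le_one_div_of_le hq0 hqp
  calc volume (cube c r) ^ (1 / p - 1 / q) * volume (F ∩ cube c r) ^ (1 / q)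
      = volume (cube c r) ^ (1 / p - 1 / q) *
        (volume (F ∩ cube c r) ^ (1 / q - 1 / p) * volume (F ∩ cube c r) ^ (1 / p)) := by
        rw [← ENNReal.rpow_add_of_nonneg _ _ hexp (by positivity)]
        congr 2; ring
    _ ≤ volume (cube c r) ^ (1 / p - 1 / q) *
        (volume (cube c r) ^ (1 / q - 1 / p) * volume F ^ (1 / p)) := by
        gcongr
        · exact Set.inter_subset_right
        · exact Set.inter_subset_left
    _ = volume F ^ (1 / p) := by
        rw [← mul_assoc, ← ENNReal.rpow_add _ _ hV0 hVt]
        simp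

lemma core {n : ℕ} (Ω : En n → ℝ) (hΩcont : ContinuousOn Ω {(0 : En n)}ᶜ)
    {κ e v : ℝ} (hκ : 0 < κ) (he : e = 1 ∨ e = -1) (hv : 0 < v)
    {Q : Set (En n)} {c' : En n} {r : ℝ} (hr : 0 < r) (hvv : volume (cube c' r) = ENNReal.ofReal v)
    (hker : ∀ x ∈ Q, ∀ y ∈ ccube c' r, x ≠ y ∧
        κ / v ≤ e * (Ω (x - y) / ‖x - y‖ ^ n))
    (T : (En n → ℂ) → (En n → ℂ)) (b : En n → ℝ) (hb : LocallyIntegrable b volume)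
    (hT : ∀ f : En n → ℂ, Integrable f → HasCompactSupport f →
          ∀ᵐ x : En n, x ∉ tsupport f →
            T f x = ∫ y, ((Ω (x - y) / ‖x - y‖ ^ n : ℝ) : ℂ) * f y)
    {F : Set (En n)} (hF : MeasurableSet F) (hFs : F ⊆ cube c' r)
    (hFv : ENNReal.ofReal v / 2 ≤ volume F) {a s : ℝ} (hs : s = 1 ∨ s = -1)
    (hFa : ∀ᵐ y, y ∈ F → s * b y ≤ s * a) :
    ∀ᵐ x, x ∈ Q → 0 < s * (b x - a) → κ / 2 * (s * (b x - a)) ≤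
      ‖(b x : ℂ) * T (F.indicator fun _ => (1 : ℂ)) x
        - T (fun y => (b y : ℂ) * F.indicator (fun _ => (1 : ℂ)) y) x‖ := by
  have hFc : F ⊆ ccube c' r := hFs.trans (cube_subset_ccube _ _)
  have hFt : volume F ≠ ⊤ := ne_top_of_le_ne_top (by rw [hvv]; exact ENNReal.ofReal_ne_top)
    (measure_mono hFs)
  have hbF : IntegrableOn b F := (hb.integrableOn_isCompact (isCompact_ccube c' r)).mono_set hFc
  set f : En n → ℂ := F.indicator fun _ => (1 : ℂ) with hf
  have hsupp : tsupport f ⊆ ccube c' r :=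
    closure_minimal ((Set.support_indicator_subset).trans hFc) (isClosed_ccube _ _)
  have hfi : Integrable f := (integrable_indicator_iff hF).2 (integrableOn_const hFt)
  have hfc : HasCompactSupport f := (isCompact_ccube c' r).of_isClosed_subset
    (isClosed_tsupport f) hsupp
  have hbf : (fun y => (b y : ℂ) * f y) = F.indicator (fun y => (b y : ℂ)) := by
    ext y
    by_cases hy : y ∈ F <;> simp [hf, hy]
  have hsupp2 : tsupport (fun y => (b y : ℂ) * f y) ⊆ ccube c' r := by
    rw [hbf]
    exact closure_minimal ((Set.support_indicator_subset).trans hFc) (isClosed_ccube _ _)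
  have hbfi : Integrable (fun y => (b y : ℂ) * f y) := by
    rw [hbf]
    exact (integrable_indicator_iff hF).2 hbF.ofReal
  have hbfc : HasCompactSupport (fun y => (b y : ℂ) * f y) :=
    (isCompact_ccube c' r).of_isClosed_subset (isClosed_tsupport _) hsupp2
  filter_upwards [hT f hfi hfc, hT _ hbfi hbfc] with x h1 h2 hx hpos
  have hxc : x ∉ ccube c' r := fun hxc => (hker x hx x hxc).1 rfl
  rw [h1 fun h => hxc (hsupp h), h2 fun h => hxc (hsupp2 h)]
  set K : En n → ℝ := fun y => Ω (x - y) / ‖x - y‖ ^ n with hK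
  have hne : ∀ y ∈ ccube c' r, x - y ≠ 0 := fun y hy => sub_ne_zero.2 (hker x hx y hy).1
  have hKc : ContinuousOn K (ccube c' r) := by
    refine ContinuousOn.div (hΩcont.comp (by fun_prop) fun y hy => hne y hy) (by fun_prop) ?_
    intro y hy
    exact pow_ne_zero _ (norm_ne_zero_iff.2 (hne y hy))
  have hKi : IntegrableOn K F :=
    (hKc.integrableOn_compact (isCompact_ccube c' r)).mono_set hFc
  have hKbi : IntegrableOn (fun y => K y * b y) F :=
    ((hb.integrableOn_isCompact (isCompact_ccube c' r)).continuousOn_mul hKc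
      (isCompact_ccube c' r)).mono_set hFc
  have e1 : ∫ y, ((K y : ℝ) : ℂ) * f y = ((∫ y in F, K y : ℝ) : ℂ) := by
    rw [← integral_complex_ofReal, ← integral_indicator hF]
    congr 1
    ext y
    by_cases hy : y ∈ F <;> simp [hf, hy]
  have e2 : ∫ y, ((K y : ℝ) : ℂ) * ((b y : ℂ) * f y) = ((∫ y in F, K y * b y : ℝ) : ℂ) := by
    rw [← integral_complex_ofReal, ← integral_indicator hF]
    congr 1
    ext y
    by_cases hy : y ∈ F <;> simp [hf, hy]
  change _ ≤ ‖(b x : ℂ) * (∫ y, ((K y : ℝ) : ℂ) * f y) -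
    ∫ y, ((K y : ℝ) : ℂ) * ((b y : ℂ) * f y)‖
  rw [e1, e2, ← Complex.ofReal_mul, ← Complex.ofReal_sub, Complex.norm_real]
  have e3 : b x * (∫ y in F, K y) - ∫ y in F, K y * b y = ∫ y in F, (b x * K y - K y * b y) := by
    rw [integral_sub (hKi.const_mul _) hKbi, integral_const_mul]
  rw [e3]
  have hIi : IntegrableOn (fun y => b x * K y - K y * b y) F := (hKi.const_mul _).sub hKbi
  have hes : |e * s| = 1 := by
    rcases he with rfl | rfl <;> rcases hs with rfl | rfl <;> simp
  have hvF : v / 2 ≤ volume.real F := by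
    have := ENNReal.toReal_mono hFt hFv
    rwa [ENNReal.toReal_div, ENNReal.toReal_ofReal hv.le] at this
  calc κ / 2 * (s * (b x - a)) = κ / v * (s * (b x - a)) * (v / 2) := by field_simp
    _ ≤ κ / v * (s * (b x - a)) * volume.real F := by gcongr
    _ = ∫ y in F, κ / v * (s * (b x - a)) := by
        rw [setIntegral_const, smul_eq_mul, mul_comm]
    _ ≤ ∫ y in F, (e * s) * (b x * K y - K y * b y) := by
        refine integral_mono_ae (integrableOn_const hFt) (hIi.const_mul _) ?_
        filter_upwards [ae_restrict_mem hF, ae_restrict_of_ae hFa] with y hy hya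
        have h3 := (hker x hx y (hFc hy)).2
        have h4 := hya hy
        change κ / v ≤ e * K y at h3
        have : (e * s) * (b x * K y - K y * b y) = (e * K y) * (s * (b x - b y)) := by ring
        change κ / v * (s * (b x - a)) ≤ (e * s) * (b x * K y - K y * b y)
        rw [this]
        have h5 : s * (b x - a) ≤ s * (b x - b y) := by linarith
        have h6 : 0 < κ / v := by positivity
        exact mul_le_mul h3 h5 hpos.le (h6.le.trans h3)
    _ = (e * s) * ∫ y in F, (b x * K y - K y * b y) := integral_const_mul _ _
    _ ≤ |(e * s) * ∫ y in F, (b x * K y - K y * b y)| := le_abs_self _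
    _ = ‖∫ y in F, (b x * K y - K y * b y)‖ := by rw [abs_mul, hes, one_mul, Real.norm_eq_abs]

lemma half_bound {n : ℕ} {p q : ℝ} (hq : 1 < q) (hqp : q ≤ p)
    (Ω : En n → ℝ) (hΩcont : ContinuousOn Ω {(0 : En n)}ᶜ)
    {κ e v : ℝ} (hκ : 0 < κ) (he : e = 1 ∨ e = -1) (hv : 0 < v)
    {c c' : En n} {r : ℝ} (hr : 0 < r) (hvv : volume (cube c' r) = ENNReal.ofReal v)
    (hvc : volume (cube c r) = ENNReal.ofReal v)
    (hker : ∀ x ∈ cube c r, ∀ y ∈ ccube c' r, x ≠ y ∧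
        κ / v ≤ e * (Ω (x - y) / ‖x - y‖ ^ n))
    (T : (En n → ℂ) → (En n → ℂ)) (b : En n → ℝ) (hb : LocallyIntegrable b volume)
    (hT : ∀ f : En n → ℂ, Integrable f → HasCompactSupport f →
          ∀ᵐ x : En n, x ∉ tsupport f →
            T f x = ∫ y, ((Ω (x - y) / ‖x - y‖ ^ n : ℝ) : ℂ) * f y)
    {M : ℝ} (hM : 0 < M)
    (hcomm : ∀ f : En n → ℂ, Measurable f → (∃ D : ℝ, ∀ x, ‖f x‖ ≤ D) →
          (∃ (c : En n) (r : ℝ), 0 < r ∧ ∀ x, x ∉ cube c r → f x = 0) →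
          weakMorreyNorm p q (fun x => (b x : ℂ) * T f x - T (fun y => (b y : ℂ) * f y) x) ≤
            ENNReal.ofReal M * morreyNorm p q f)
    {F : Set (En n)} (hF : MeasurableSet F) (hFs : F ⊆ cube c' r)
    (hFv : ENNReal.ofReal v / 2 ≤ volume F) {a s : ℝ} (hs : s = 1 ∨ s = -1)
    (hFa : ∀ᵐ y, y ∈ F → s * b y ≤ s * a) :
    ∫⁻ x in cube c r, ENNReal.ofReal (s * (b x - a)) ≤
      ENNReal.ofReal (q / (q - 1) * (2 * M / κ) * v) := by
  have hq0 : 0 < q := by linarith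
  have hp0 : 0 < p := by linarith
  have hmQ : MeasurableSet (cube c r) := (isOpen_cube c r).measurableSet
  refine layer _ _ ?_ (by positivity) hv hq (by simp [hvc]) ?_
  · have : AEMeasurable b := hb.aestronglyMeasurable.aemeasurable
    exact ((this.sub_const a).const_mul s).restrict
  intro t ht
  have hcore := core Ω hΩcont hκ he hv hr hvv hker T b hb hT hF hFs hFv hs hFa
  set f : En n → ℂ := F.indicator fun _ => (1 : ℂ) with hf
  have hw := hcomm f (measurable_const.indicator hF)
    ⟨1, fun x => by by_cases hx : x ∈ F <;> simp [hf, hx]⟩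
    ⟨c', r, hr, fun x hx => Set.indicator_of_notMem (fun h => hx (hFs h)) _⟩
  set G : En n → ℂ := fun x => (b x : ℂ) * T f x - T (fun y => (b y : ℂ) * f y) x with hG
  have hmf : morreyNorm p q f ≤ ENNReal.ofReal v ^ (1 / p) := by
    refine (morrey_indicator hq hqp F hF).trans ?_
    rw [← hvv]
    gcongr
  have hτ : 0 < κ / 2 * t := by positivity
  have hle : volume (cube c r) ^ (1 / p - 1 / q) *
      (ENNReal.ofReal (κ / 2 * t) ^ q * volume {y ∈ cube c r | κ / 2 * t < ‖G y‖}) ^ (1 / q)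
      ≤ weakMorreyNorm p q G := by
    unfold weakMorreyNorm
    refine le_trans ?_ (le_iSup_of_le c (le_iSup_of_le r (le_iSup_of_le hr le_rfl)))
    gcongr
    exact le_iSup₂_of_le (κ / 2 * t) hτ le_rfl
  have hsub : volume.restrict (cube c r) {x | t < s * (b x - a)} ≤
      volume {y ∈ cube c r | κ / 2 * t < ‖G y‖} := by
    rw [Measure.restrict_apply' hmQ]
    refine measure_mono_ae ?_
    filter_upwards [hcore] with x hx hx2
    obtain ⟨hx3, hx4⟩ := hx2
    have hx3' : t < s * (b x - a) := hx3
    refine ⟨hx4, lt_of_lt_of_le ?_ (hx hx4 (ht.trans hx3'))⟩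
    gcongr
  refine hsub.trans ?_
  set W := volume {y ∈ cube c r | κ / 2 * t < ‖G y‖} with hW
  have hvne : ENNReal.ofReal v ≠ 0 := by simpa using hv
  have hvtop : ENNReal.ofReal v ≠ ⊤ := ENNReal.ofReal_ne_top
  have h1 : ENNReal.ofReal v ^ (1 / p - 1 / q) * (ENNReal.ofReal (κ / 2 * t) ^ q * W) ^ (1 / q)
      ≤ ENNReal.ofReal M * ENNReal.ofReal v ^ (1 / p) := by
    rw [← hvc]
    refine hle.trans (hw.trans ?_)
    rw [hvc]
    gcongr
  have h2 : (ENNReal.ofReal (κ / 2 * t) ^ q * W) ^ (1 / q)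
      ≤ ENNReal.ofReal M * ENNReal.ofReal v ^ (1 / q) := by
    have h3 := mul_le_mul_right h1 (ENNReal.ofReal v ^ (1 / q - 1 / p))
    rw [← mul_assoc, ← ENNReal.rpow_add _ _ hvne hvtop, mul_left_comm,
      ← ENNReal.rpow_add _ _ hvne hvtop] at h3
    simpa using h3
  have h3 : ENNReal.ofReal (κ / 2 * t) ^ q * W ≤ ENNReal.ofReal M ^ q * ENNReal.ofReal v := by
    have h4 := ENNReal.rpow_le_rpow h2 hq0.le
    rw [ENNReal.mul_rpow_of_nonneg _ _ hq0.le, ← ENNReal.rpow_mul, ← ENNReal.rpow_mul,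
      one_div_mul_cancel hq0.ne', ENNReal.rpow_one, ENNReal.rpow_one] at h4
    exact h4
  have h5 : ENNReal.ofReal (κ / 2 * t) ^ q = ENNReal.ofReal ((κ / 2 * t) ^ q) :=
    ENNReal.ofReal_rpow_of_pos hτ
  have h6 : ENNReal.ofReal M ^ q * ENNReal.ofReal v =
      ENNReal.ofReal ((κ / 2 * t) ^ q) * ENNReal.ofReal ((2 * M / κ / t) ^ q * v) := by
    rw [ENNReal.ofReal_rpow_of_pos hM, ← ENNReal.ofReal_mul (by positivity),
      ← ENNReal.ofReal_mul (by positivity), ← mul_assoc, ← Real.mul_rpow (by positivity)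
      (by positivity)]
    congr 3
    field_simp
  rw [h5, h6] at h3
  have hpos : 0 < (κ / 2 * t) ^ q := by positivity
  exact (ENNReal.mul_le_mul_iff_right (by simpa using hpos) ENNReal.ofReal_ne_top).1 h3

lemma osc_bound {n : ℕ} (b : En n → ℝ) (hb : LocallyIntegrable b volume) {c : En n} {r v B : ℝ}
    (hv : 0 < v) (hvc : volume (cube c r) = ENNReal.ofReal v) (hB : 0 ≤ B) (a : ℝ)
    (h : ∫⁻ x in cube c r, (‖b x - a‖₊ : ℝ≥0∞) ≤ ENNReal.ofReal (B * v)) :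
    (volume (cube c r))⁻¹ * ∫⁻ x in cube c r, (‖b x - cubeAvg b c r‖₊ : ℝ≥0∞) ≤
      ENNReal.ofReal (2 * B) := by
  have hbi : IntegrableOn b (cube c r) :=
    (hb.integrableOn_isCompact (isCompact_ccube c r)).mono_set (cube_subset_ccube _ _)
  have hft : volume (cube c r) ≠ ⊤ := by rw [hvc]; exact ENNReal.ofReal_ne_top
  have hreal : volume.real (cube c r) = v := by
    rw [measureReal_def, hvc, ENNReal.toReal_ofReal hv.le]
  have hai : IntegrableOn (fun _ : En n => a) (cube c r) := integrableOn_const hft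
  have havg : ‖a - cubeAvg b c r‖ ≤ B := by
    have h1 : cubeAvg b c r - a = (∫ x in cube c r, (b x - a)) / v := by
      rw [integral_sub hbi hai, setIntegral_const, hreal, cubeAvg, ← measureReal_def, hreal,
        smul_eq_mul]
      field_simp
    rw [norm_sub_rev, h1, norm_div, Real.norm_of_nonneg hv.le, div_le_iff₀ hv]
    have h2 := enorm_integral_le_lintegral_enorm (μ := volume.restrict (cube c r))
      (fun x => b x - a)
    have h3 := h2.trans h
    rw [← ofReal_norm] at h3
    exact (ENNReal.ofReal_le_ofReal_iff (by positivity)).1 h3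
  have hsum : ∫⁻ x in cube c r, (‖b x - cubeAvg b c r‖₊ : ℝ≥0∞) ≤ ENNReal.ofReal (2 * B * v) := by
    calc ∫⁻ x in cube c r, (‖b x - cubeAvg b c r‖₊ : ℝ≥0∞)
        ≤ ∫⁻ x in cube c r, ((‖b x - a‖₊ : ℝ≥0∞) + ENNReal.ofReal B) := by
          refine lintegral_mono fun x => ?_
          have h1 : b x - cubeAvg b c r = (b x - a) + (a - cubeAvg b c r) := by ring
          rw [h1]
          refine (enorm_add_le (b x - a) (a - cubeAvg b c r)).trans ?_
          refine add_le_add le_rfl ?_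
          rw [← ofReal_norm]
          exact ENNReal.ofReal_le_ofReal havg
      _ = (∫⁻ x in cube c r, (‖b x - a‖₊ : ℝ≥0∞)) + ENNReal.ofReal (B * v) := by
          rw [lintegral_add_right _ measurable_const, setLIntegral_const, hvc,
            ENNReal.ofReal_mul hB]
      _ ≤ ENNReal.ofReal (B * v) + ENNReal.ofReal (B * v) := by gcongr
      _ = ENNReal.ofReal (2 * B * v) := by
          rw [← ENNReal.ofReal_add (by positivity) (by positivity)]
          congr 1; ring
  calc _ ≤ (ENNReal.ofReal v)⁻¹ * ENNReal.ofReal (2 * B * v) := by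
        rw [hvc]; gcongr
    _ = ENNReal.ofReal (2 * B) := by
        rw [← ENNReal.ofReal_inv_of_pos hv, ← ENNReal.ofReal_mul (by positivity)]
        congr 1; field_simp

lemma main_pos {n : ℕ} {p q : ℝ} (hq : 1 < q) (hqp : q ≤ p)
    (Ω : En n → ℝ) (hΩcont : ContinuousOn Ω {(0 : En n)}ᶜ)
    {u : En n} {κ e : ℝ} (hκ : 0 < κ) (he : e = 1 ∨ e = -1)
    (hker : ∀ (c : En n) (r : ℝ), 0 < r →
      ∀ x ∈ cube c r, ∀ y ∈ ccube (c - r • u) r, x ≠ y ∧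
        κ / (2 * r) ^ n ≤ e * (Ω (x - y) / ‖x - y‖ ^ n))
    (T : (En n → ℂ) → (En n → ℂ)) (b : En n → ℝ) (hb : LocallyIntegrable b volume)
    (hT : ∀ f : En n → ℂ, Integrable f → HasCompactSupport f →
          ∀ᵐ x : En n, x ∉ tsupport f →
            T f x = ∫ y, ((Ω (x - y) / ‖x - y‖ ^ n : ℝ) : ℂ) * f y)
    {M : ℝ} (hM : 0 < M)
    (hcomm : ∀ f : En n → ℂ, Measurable f → (∃ D : ℝ, ∀ x, ‖f x‖ ≤ D) →
          (∃ (c : En n) (r : ℝ), 0 < r ∧ ∀ x, x ∉ cube c r → f x = 0) →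
          weakMorreyNorm p q (fun x => (b x : ℂ) * T f x - T (fun y => (b y : ℂ) * f y) x) ≤
            ENNReal.ofReal M * morreyNorm p q f) :
    bmoSeminorm b ≤ ENNReal.ofReal (8 * q / (q - 1) / κ * M) := by
  have hq1 : 0 < q - 1 := by linarith
  unfold bmoSeminorm
  refine iSup_le fun c => iSup_le fun r => iSup_le fun hr => ?_
  set v : ℝ := (2 * r) ^ n with hvdef
  have hv : 0 < v := by positivity
  set c' : En n := c - r • u with hc'
  have hvc : volume (cube c r) = ENNReal.ofReal v := volume_cube c hr
  have hvc' : volume (cube c' r) = ENNReal.ofReal v := volume_cube c' hr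
  have hmQ' : MeasurableSet (cube c' r) := (isOpen_cube c' r).measurableSet
  have hbm : AEMeasurable b := hb.aestronglyMeasurable.aemeasurable
  set g : En n → ℝ := hbm.mk b with hg
  have hgm : Measurable g := hbm.measurable_mk
  have hgb : ∀ᵐ x, b x = g x := hbm.ae_eq_mk
  haveI : IsFiniteMeasure (volume.restrict (cube c' r)) :=
    ⟨by rw [Measure.restrict_apply_univ, hvc']; exact ENNReal.ofReal_lt_top⟩
  obtain ⟨a, ha1, ha2⟩ := median_exists (volume.restrict (cube c' r))
    (by rw [Measure.restrict_apply_univ, hvc']; simpa using hv) g hgm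
  rw [Measure.restrict_apply_univ, hvc', Measure.restrict_apply' hmQ'] at ha1 ha2
  have hk := hker c r hr
  have H1 := half_bound hq hqp Ω hΩcont hκ he hv hr hvc' hvc hk T b hb hT hM hcomm
    (F := {x | g x ≤ a} ∩ cube c' r) ((hgm measurableSet_Iic).inter hmQ') Set.inter_subset_right
    ha1 (a := a) (s := 1) (Or.inl rfl) (by
      filter_upwards [hgb] with y hy hyF
      have : g y ≤ a := hyF.1
      rw [hy]; linarith)
  have H2 := half_bound hq hqp Ω hΩcont hκ he hv hr hvc' hvc hk T b hb hT hM hcomm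
    (F := {x | a ≤ g x} ∩ cube c' r) ((hgm measurableSet_Ici).inter hmQ') Set.inter_subset_right
    ha2 (a := a) (s := -1) (Or.inr rfl) (by
      filter_upwards [hgb] with y hy hyF
      have : a ≤ g y := hyF.1
      rw [hy]; linarith)
  have hosc : ∫⁻ x in cube c r, (‖b x - a‖₊ : ℝ≥0∞) ≤
      ENNReal.ofReal (4 * q / (q - 1) / κ * M * v) := by
    calc ∫⁻ x in cube c r, (‖b x - a‖₊ : ℝ≥0∞)
        ≤ ∫⁻ x in cube c r, (ENNReal.ofReal (1 * (b x - a)) + ENNReal.ofReal (-1 * (b x - a))) := by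
          refine lintegral_mono fun x => ?_
          change ‖b x - a‖ₑ ≤ _
          rw [← ofReal_norm, Real.norm_eq_abs]
          rcases abs_cases (b x - a) with ⟨h, _⟩ | ⟨h, _⟩
          · rw [h, one_mul]; exact le_self_add
          · rw [h, neg_one_mul]; exact le_add_self
      _ = (∫⁻ x in cube c r, ENNReal.ofReal (1 * (b x - a))) +
          ∫⁻ x in cube c r, ENNReal.ofReal (-1 * (b x - a)) := by
          refine lintegral_add_left' ?_ _
          exact ((hbm.sub_const a).const_mul 1).ennreal_ofReal.restrict
      _ ≤ _ := add_le_add H1 H2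
      _ = _ := by
          rw [← ENNReal.ofReal_add (by positivity) (by positivity)]
          congr 1; ring
  refine (osc_bound b hb hv hvc (by positivity) a hosc).trans (le_of_eq ?_)
  congr 1; ring

/-- If `1 < q ≤ p < ∞` and `‖[b,T]f‖_{WM^p_q} ≤ M ‖f‖_{M^p_q}` for all bounded
measurable `f` supported in a cube, then `b ∈ BMO` with `‖b‖_* ≤ C M`, where `C` depends
only on `n`, `p`, `q` and `Ω`. -/
theorem bmo_of_commutator_weak_Morrey_bound (n : ℕ) (p q : ℝ) (hq : 1 < q) (hqp : q ≤ p)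
    (Ω : En n → ℝ)
    (hΩhom : ∀ l : ℝ, 0 < l → ∀ x : En n, x ≠ 0 → Ω (l • x) = Ω x)
    (hΩsmooth : ContDiffOn ℝ (⊤ : ℕ∞) Ω {(0 : En n)}ᶜ)
    (hΩne : ∃ x : En n, x ≠ 0 ∧ Ω x ≠ 0)
    (hΩzero : ∫ θ : Metric.sphere (0 : En n) 1, Ω (θ : En n)
        ∂(volume : Measure (En n)).toSphere = 0) :
    ∃ C : ℝ, 0 < C ∧
      ∀ (T : (En n → ℂ) → (En n → ℂ)) (b : En n → ℝ) (M : ℝ),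
        LocallyIntegrable b volume →
        (∀ f : En n → ℂ, Integrable f → HasCompactSupport f →
          ∀ᵐ x : En n, x ∉ tsupport f →
            T f x = ∫ y, ((Ω (x - y) / ‖x - y‖ ^ n : ℝ) : ℂ) * f y) →
        0 ≤ M →
        (∀ f : En n → ℂ, Measurable f → (∃ D : ℝ, ∀ x, ‖f x‖ ≤ D) →
          (∃ (c : En n) (r : ℝ), 0 < r ∧ ∀ x, x ∉ cube c r → f x = 0) →
          weakMorreyNorm p q (fun x => (b x : ℂ) * T f x - T (fun y => (b y : ℂ) * f y) x) ≤
            ENNReal.ofReal M * morreyNorm p q f) →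
        bmoSeminorm b ≤ ENNReal.ofReal (C * M) := by
  have hΩcont := hΩsmooth.continuousOn
  obtain ⟨u, κ, e, hκ, he, hker⟩ := kernel_lower Ω hΩhom hΩcont hΩne
  have hq1 : 0 < q - 1 := by linarith
  refine ⟨8 * q / (q - 1) / κ, by positivity, ?_⟩
  intro T b M hb hT hM hcomm
  have key : ∀ ε : ℝ, 0 < ε → bmoSeminorm b ≤
      ENNReal.ofReal (8 * q / (q - 1) / κ * (M + ε)) := by
    intro ε hε
    refine main_pos hq hqp Ω hΩcont hκ he hker T b hb hT (by linarith) ?_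
    intro f hf1 hf2 hf3
    refine (hcomm f hf1 hf2 hf3).trans ?_
    gcongr
    linarith
  have hlim : Filter.Tendsto (fun ε : ℝ => ENNReal.ofReal (8 * q / (q - 1) / κ * (M + ε)))
      (nhdsWithin 0 (Set.Ioi 0)) (nhds (ENNReal.ofReal (8 * q / (q - 1) / κ * (M + 0)))) := by
    refine Filter.Tendsto.mono_left (Continuous.tendsto ?_ 0) nhdsWithin_le_nhds
    exact ENNReal.continuous_ofReal.comp (by fun_prop)
  rw [add_zero] at hlim
  refine ge_of_tendsto hlim ?_
  filter_upwards [self_mem_nhdsWithin] with ε hε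
  exact key ε hε
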